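/- Consider any allocation process on n bins which at each round t ≥ 0 picks a bin i^t uniformly at random and increments the load of bin i^t by some number f^t ≥ 1 of balls, where f^t may depend on the history F^t and on i^t. Then the probability that Gap(n/2) ≥ (1/10)·(log n)/(log log n) is at least 1 − o(1) as n → ∞. -/

import Mathlib

open MeasureTheory ProbabilityTheory Real Finset
open scoped ENNReal Classical

noncomputable section

/-- An allocation process on `n` bins: a probability space with a filtration,
load vectors `x t`, and a sampled bin `sel t` in each round. -/
structure AllocProc (n : ℕ) where
  Ω : Type
  m0 : MeasurableSpace Ω
  μ : Measure Ω
  prob : IsProbabilityMeasure μ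
  F : Filtration ℕ m0
  x : ℕ → Ω → Fin n → ℕ
  sel : ℕ → Ω → Fin n
  x_zero : ∀ ω i, x 0 ω i = 0
  meas_x : ∀ t i, Measurable[F t] fun ω => x t ω i
  meas_sel : ∀ t, Measurable[F (t + 1)] (sel t)

namespace AllocProc

variable {n : ℕ} (P : AllocProc n)

/-- Total number of balls allocated after `t` rounds. -/
def W (t : ℕ) (ω : P.Ω) : ℕ := ∑ i, P.x t ω i

/-- Normalized load of bin `i` after `t` rounds. -/
def y (t : ℕ) (ω : P.Ω) (i : Fin n) : ℝ := (P.x t ω i : ℝ) - (P.W t ω : ℝ) / n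

/-- The gap between maximum and average load after `t` rounds. -/
def Gap (t : ℕ) (ω : P.Ω) : ℝ := (⨆ i, (P.x t ω i : ℝ)) - (P.W t ω : ℝ) / n

/-- The absolute value potential `Δ^t`. -/
def Δpot (t : ℕ) (ω : P.Ω) : ℝ := ∑ i, |P.y t ω i|

/-- Condition `𝒫`: in each round the sampled bin is chosen according to a probability
vector (conditional on the past) which, indexed by decreasing load, is majorized by the
uniform distribution. -/
def CondP : Prop :=
  ∃ σ : ℕ → P.Ω → Equiv.Perm (Fin n),
    (∀ t ω, Antitone fun k => P.y t ω (σ t ω k)) ∧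
    (∀ (t k : ℕ),
      ∀ᵐ ω ∂P.μ,
        (P.μ[({ω' | ((σ t ω').symm (P.sel t ω') : ℕ) < k} : Set P.Ω).indicator
            (fun _ => (1 : ℝ)) | P.F t]) ω ≤ (k : ℝ) / n)

/-- Condition `𝒲`: if the sampled bin is overloaded it gets one ball; otherwise exactly
`⌈-y⌉ + 1` balls are placed into underloaded bins, with at most one bin receiving
`⌈-y⌉ + 1` balls, at most one receiving `⌈-y⌉` balls, and all others at most `⌈-y⌉ - 1`. -/
def CondW : Prop :=
  ∀ t ω,
    (0 ≤ P.y t ω (P.sel t ω) →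
      ∀ j, P.x (t + 1) ω j = P.x t ω j + if j = P.sel t ω then 1 else 0) ∧
    (P.y t ω (P.sel t ω) < 0 →
      (∀ j, P.x t ω j ≤ P.x (t + 1) ω j) ∧
      (∀ j, 0 ≤ P.y t ω j → P.x (t + 1) ω j = P.x t ω j) ∧
      (P.W (t + 1) ω = P.W t ω + ⌈-(P.y t ω (P.sel t ω))⌉₊ + 1) ∧
      (∃ k1 k2 : Fin n, P.y t ω k1 < 0 ∧ P.y t ω k2 < 0 ∧
        ((P.x (t + 1) ω k1 : ℤ) ≤ (P.x t ω k1 : ℤ) + ⌈-(P.y t ω k1)⌉ + 1) ∧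
        ((P.x (t + 1) ω k2 : ℤ) ≤ (P.x t ω k2 : ℤ) + ⌈-(P.y t ω k2)⌉) ∧
        (∀ j, P.y t ω j < 0 → j ≠ k1 → j ≠ k2 →
          (P.x (t + 1) ω j : ℤ) ≤ (P.x t ω j : ℤ) + ⌈-(P.y t ω j)⌉ - 1)))

/-- The bin sampled in each round is uniform, conditionally on the past. -/
def UniformSampling : Prop :=
  ∀ (t : ℕ) (i : Fin n),
    ∀ᵐ ω ∂P.μ,
      (P.μ[({ω' | P.sel t ω' = i} : Set P.Ω).indicator (fun _ => (1 : ℝ)) | P.F t]) ω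
        = 1 / n

/-- The allocation rule of the `Packing` process: one ball into the sampled bin if it is
overloaded; otherwise the sampled bin is filled up to load `⌈W^t/n⌉ + 1`. -/
def PackingRule : Prop :=
  ∀ t ω j,
    P.x (t + 1) ω j =
      if j = P.sel t ω then
        if (P.W t ω : ℝ) / n ≤ (P.x t ω j : ℝ) then P.x t ω j + 1
        else ⌈(P.W t ω : ℝ) / n⌉₊ + 1
      else P.x t ω j

/-- The `Packing` process: uniform sampling together with the packing allocation rule. -/
def IsPacking : Prop := P.UniformSampling ∧ P.PackingRule

/-- The exponential potential `Φ^t(α)`, over bins overloaded by at least two balls. -/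
def Φ (α : ℝ) (t : ℕ) (ω : P.Ω) : ℝ :=
  ∑ i, if 2 ≤ P.y t ω i then Real.exp (α * P.y t ω i) else 0

end AllocProc

namespace AllocProc

variable {n : ℕ} (P : AllocProc n)

/-- The "good event" `𝒢^t`: at least `n/20` underloaded bins, or `Δ^t ≥ n/10`. -/
def Gev (t : ℕ) : Set P.Ω :=
  {ω | (n : ℝ) / 20 ≤ ((Finset.univ.filter fun i => P.y t ω i < 0).card : ℝ) ∨
       (n : ℝ) / 10 ≤ P.Δpot t ω}

/-- `G_{t0}^s`: number of rounds `r ∈ [t0, s)` in which the good event `𝒢^r` holds. -/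
def GCount (t0 s : ℕ) (ω : P.Ω) : ℕ :=
  ((Finset.Ico t0 s).filter fun r => ω ∈ P.Gev r).card

/-- The adjusted potential `Φ̃^s` (relative to a starting round `t0`). -/
def tildePhi (α c1 c2 c3 : ℝ) (t0 s : ℕ) (ω : P.Ω) : ℝ :=
  P.Φ α s ω * Real.exp (c2 * α / n * (P.GCount t0 (s - 1) ω : ℝ)) *
      Real.exp (-(c1 * α ^ 2 / n) * (((s - 1 - t0) - P.GCount t0 (s - 1) ω : ℕ) : ℝ)) -
    c3 * ((s - t0 : ℕ) : ℝ)

/-- An `(a,b)`-biased sampling vector: conditionally on the past, each bin is sampled with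
probability between `1/(a n)` and `b/n`. -/
def BiasedSampling (a b : ℝ) : Prop :=
  ∀ (t : ℕ) (i : Fin n),
    ∀ᵐ ω ∂P.μ,
      1 / (a * n) ≤
          (P.μ[({ω' | P.sel t ω' = i} : Set P.Ω).indicator (fun _ => (1 : ℝ)) | P.F t]) ω ∧
        (P.μ[({ω' | P.sel t ω' = i} : Set P.Ω).indicator (fun _ => (1 : ℝ)) | P.F t]) ω ≤ b / n

/-- The exponential potential over all non-underloaded bins. -/
def Ψ (α : ℝ) (t : ℕ) (ω : P.Ω) : ℝ :=
  ∑ i, if 0 ≤ P.y t ω i then Real.exp (α * P.y t ω i) else 0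

/-- An unfolding of the process `P`: one ball is allocated per atomic allocation, balls are
never removed, and after `W^t` atomic allocations the load vector agrees with `x^t`. -/
def IsUnfolding (u : ℕ → P.Ω → Fin n → ℕ) : Prop :=
  (∀ ω i, u 0 ω i = 0) ∧
  (∀ s ω, (∀ i, u s ω i ≤ u (s + 1) ω i) ∧ (∑ i, u (s + 1) ω i) = (∑ i, u s ω i) + 1) ∧
  (∀ t ω, u (P.W t ω) ω = P.x t ω)

/-- The gap of an unfolding after `s` atomic allocations. -/
def GapU (u : ℕ → P.Ω → Fin n → ℕ) (s : ℕ) (ω : P.Ω) : ℝ :=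
  (⨆ i, (u s ω i : ℝ)) - (s : ℝ) / n

end AllocProc

/-- The number of balls that the assignment `c` puts into bin `i`. -/
def hits {b n : ℕ} (i : Fin n) (c : Fin b → Fin n) : ℝ := ∑ s, if c s = i then 1 else 0

theorem hits_cons {b n : ℕ} (i v : Fin n) (c : Fin b → Fin n) :
    hits i (Fin.cons v c : Fin (b + 1) → Fin n) = (if v = i then 1 else 0) + hits i c := by
  rw [hits, Fin.sum_univ_succ]
  simp [hits]

theorem sum_fun_succ {b n : ℕ} (g : (Fin (b + 1) → Fin n) → ℝ) :
    ∑ c, g c = ∑ v : Fin n, ∑ c : Fin b → Fin n, g (Fin.cons v c) := by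
  rw [← (Fin.consEquiv (fun _ : Fin (b + 1) => Fin n)).sum_comp, Fintype.sum_prod_type]
  rfl

theorem sum_hits {n : ℕ} (hn : 0 < n) (i : Fin n) (b : ℕ) :
    ∑ c : Fin b → Fin n, hits i c = (b : ℝ) / n * (n : ℝ) ^ b := by
  have hn' : (n : ℝ) ≠ 0 := by positivity
  induction b with
  | zero => simp [hits]
  | succ b ih =>
    rw [sum_fun_succ]
    simp only [hits_cons, sum_add_distrib, ih]
    simp
    field_simp
    ring

theorem sum_hits_mul_hits {n : ℕ} (hn : 0 < n) (i i' : Fin n) (b : ℕ) :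
    ∑ c : Fin b → Fin n, hits i c * hits i' c =
      ((if i = i' then (b : ℝ) / n else 0) + b * (b - 1) / n ^ 2) * (n : ℝ) ^ b := by
  have hn' : (n : ℝ) ≠ 0 := by positivity
  induction b with
  | zero => simp [hits]
  | succ b ih =>
    rw [sum_fun_succ]
    simp only [hits_cons, add_mul, mul_add, sum_add_distrib, ih, ← mul_sum, ← sum_mul,
      sum_hits hn]
    by_cases h : i = i'
    · subst h
      simp
      field_simp
      ring
    · simp [h, Ne.symm h]
      field_simp
      ring

/-- Second moment bound: few assignments leave, for every bin, some block without a ball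
in that bin. -/
theorem card_no_bin_hit_in_all_blocks {n b : ℕ} (k : ℕ) (hn : 0 < n) (hb : 0 < b) (hbn : b ≤ n) :
    ((univ.filter fun a : Fin k → Fin b → Fin n => ∀ i, ∃ j, ∀ s, a j s ≠ i).card : ℝ) ≤
      (2 * n / b) ^ k / n * ((n : ℝ) ^ b) ^ k := by
  have hn' : (0 : ℝ) < n := by positivity
  have hb' : (0 : ℝ) < b := by positivity
  have hb1 : (1 : ℝ) ≤ b := by exact_mod_cast hb
  have hbn' : (b : ℝ) ≤ n := by exact_mod_cast hbn
  set X : (Fin k → Fin b → Fin n) → ℝ := fun a => ∑ i, ∏ j, hits i (a j) with hX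
  set p : ℝ := (b : ℝ) / n with hp
  have hp0 : 0 < p := by positivity
  have hp1 : p ≤ 1 := by rw [hp, div_le_one hn']; exact hbn'
  set T : ℝ := (n : ℝ) ^ b with hT
  have hT0 : 0 < T := by positivity
  set M : ℝ := n * p ^ k with hM
  have hM0 : 0 < M := by positivity
  have first : ∑ a, X a = M * T ^ k := by
    simp only [hX]
    rw [sum_comm]
    have : ∀ i : Fin n, ∑ a : Fin k → Fin b → Fin n, ∏ j, hits i (a j) = (p * T) ^ k := by
      intro i
      rw [← sum_hits hn i b, Fintype.sum_pow]
    simp [this, mul_pow, hM, mul_assoc]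
  have second : ∑ a, X a ^ 2 ≤ (M ^ 2 + n * (2 * p) ^ k) * T ^ k := by
    have expand : ∑ a, X a ^ 2 = ∑ i : Fin n, ∑ i' : Fin n,
        (((if i = i' then p else 0) + b * (b - 1) / n ^ 2) * T) ^ k := by
      simp only [hX, sq, sum_mul_sum, ← prod_mul_distrib]
      rw [sum_comm]
      refine sum_congr rfl fun i _ => ?_
      rw [sum_comm]
      refine sum_congr rfl fun i' _ => ?_
      have := sum_hits_mul_hits hn i i' b
      rw [← sq, ← this, Fintype.sum_pow]
    have hq0 : (0 : ℝ) ≤ b * (b - 1) / n ^ 2 := by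
      have : (0 : ℝ) ≤ b - 1 := by linarith
      positivity
    have hq : (b : ℝ) * (b - 1) / n ^ 2 ≤ p ^ 2 := by
      rw [hp, div_pow]
      gcongr
      nlinarith
    rw [expand]
    calc _ ≤ ∑ i : Fin n, ∑ i' : Fin n,
          ((p ^ 2 * T) ^ k + if i = i' then (2 * p * T) ^ k else 0) := by
          refine sum_le_sum fun i _ => sum_le_sum fun i' _ => ?_
          split_ifs
          · have : (0 : ℝ) ≤ (p ^ 2 * T) ^ k := by positivity
            refine le_trans (pow_le_pow_left₀ (by positivity) ?_ k) (le_add_of_nonneg_left this)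
            gcongr
            nlinarith
          · rw [zero_add, add_zero]
            gcongr
      _ = _ := by
          simp [sum_add_distrib, mul_pow, hM]
          ring
  have cheb : ((univ.filter fun a : Fin k → Fin b → Fin n => ∀ i, ∃ j, ∀ s, a j s ≠ i).card : ℝ)
      * M ^ 2 ≤ ∑ a, (X a - M) ^ 2 := by
    rw [← nsmul_eq_mul, ← sum_const]
    refine (sum_le_sum fun a ha => ?_).trans
      (sum_le_sum_of_subset_of_nonneg (subset_univ _) fun _ _ _ => sq_nonneg _)
    have : X a = 0 := by
      refine sum_eq_zero fun i _ => ?_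
      obtain ⟨j, hj⟩ := (mem_filter.1 ha).2 i
      exact prod_eq_zero (mem_univ j) (by simp [hits, hj])
    simp [this]
  have var : ∑ a, (X a - M) ^ 2 ≤ n * (2 * p) ^ k * T ^ k := by
    have : ∑ a, (X a - M) ^ 2 = ∑ a, X a ^ 2 - 2 * M * ∑ a, X a + M ^ 2 * T ^ k := by
      simp only [sub_sq, sum_add_distrib, sum_sub_distrib, mul_sum]
      congr 1
      · congr 1
        exact sum_congr rfl fun a _ => by ring
      · simp [hT, mul_comm]
    rw [this, first]
    linarith
  have key := (le_div_iff₀ (by positivity)).2 (cheb.trans var)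
  refine key.trans (le_of_eq ?_)
  have h2 : 2 * (n : ℝ) / b = 2 / p := by rw [hp]; field_simp
  clear_value p
  rw [h2, hM, div_pow, mul_pow]
  field_simp

namespace AllocProc

variable {n : ℕ} (P : AllocProc n)

theorem measurableSet_sel_eq (t : ℕ) (i : Fin n) :
    MeasurableSet[P.F (t + 1)] {ω | P.sel t ω = i} :=
  P.meas_sel t (measurableSet_singleton i)

theorem measurableSet_sel_prefix (m : ℕ) (a : ℕ → Fin n) :
    MeasurableSet[P.F m] {ω | ∀ t < m, P.sel t ω = a t} := by
  have : {ω | ∀ t < m, P.sel t ω = a t} = ⋂ t ∈ range m, {ω | P.sel t ω = a t} := by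
    ext ω; simp
  rw [this]
  refine Finset.measurableSet_biInter _ fun t ht => ?_
  exact P.F.mono (Nat.succ_le_of_lt (mem_range.1 ht)) _ (P.measurableSet_sel_eq t (a t))

variable {P}

theorem UniformSampling.measureReal_sel_prefix (h : P.UniformSampling) (m : ℕ) (a : ℕ → Fin n) :
    P.μ.real {ω | ∀ t < m, P.sel t ω = a t} = (1 / (n : ℝ)) ^ m := by
  have := P.prob
  let _ := P.m0
  induction m with
  | zero => simp
  | succ m ih =>
    have hA := P.measurableSet_sel_prefix m a
    have hB : MeasurableSet {ω | P.sel m ω = a m} :=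
      P.F.le _ _ (P.measurableSet_sel_eq m (a m))
    have hset : {ω | ∀ t < m + 1, P.sel t ω = a t} =
        {ω | ∀ t < m, P.sel t ω = a t} ∩ {ω | P.sel m ω = a m} := by
      ext ω
      simp only [Set.mem_ofPred_eq, Set.mem_inter_iff, Nat.lt_succ_iff_lt_or_eq]
      exact ⟨fun H => ⟨fun t ht => H t (Or.inl ht), H m (Or.inr rfl)⟩,
        fun H t ht => ht.elim (H.1 t) fun e => e ▸ H.2⟩
    have hint : Integrable ({ω | P.sel m ω = a m}.indicator fun _ => (1 : ℝ)) P.μ :=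
      (integrable_const 1).indicator hB
    have key := setIntegral_condExp (P.F.le m) hint hA
    rw [setIntegral_congr_ae (g := fun _ => 1 / (n : ℝ)) (P.F.le m _ hA)
      ((h m (a m)).mono fun ω hω _ => hω)] at key
    rw [setIntegral_const, setIntegral_indicator hB, setIntegral_const, ih, ← hset] at key
    simpa [pow_succ] using key.symm

theorem UniformSampling.measure_sel_mem_le (h : P.UniformSampling) (m : ℕ)
    (B : Finset (Fin m → Fin n)) :
    P.μ {ω | (fun t : Fin m => P.sel t ω) ∈ B} ≤
      ENNReal.ofReal (B.card * (1 / (n : ℝ)) ^ m) := by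
  have := P.prob
  let _ := P.m0
  have hset : {ω | (fun t : Fin m => P.sel t ω) ∈ B} ⊆
      ⋃ a ∈ B, {ω | ∀ t : Fin m, P.sel t ω = a t} := by
    intro ω hω
    simp only [Set.mem_iUnion]
    exact ⟨_, hω, fun _ => rfl⟩
  refine (measure_mono hset).trans ((measure_biUnion_finset_le _ _).trans ?_)
  have hone : ∀ a ∈ B, P.μ {ω | ∀ t : Fin m, P.sel t ω = a t} ≤
      ENNReal.ofReal ((1 / (n : ℝ)) ^ m) := by
    intro a _
    obtain ⟨ω₀⟩ : Nonempty P.Ω := P.μ.nonempty_of_neZero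
    have hs := h.measureReal_sel_prefix m
      (fun t => if ht : t < m then a ⟨t, ht⟩ else P.sel 0 ω₀)
    rw [← hs, ofReal_measureReal]
    refine measure_mono fun ω hω t ht => ?_
    simpa [ht] using hω ⟨t, ht⟩
  refine (sum_le_sum hone).trans (le_of_eq ?_)
  rw [sum_const, nsmul_eq_mul, ENNReal.ofReal_mul (by positivity), ENNReal.ofReal_natCast]

variable (P)

theorem card_filter_sel_le_x
    (hx : ∀ t ω, ∃ f : ℕ, 1 ≤ f ∧
      ∀ j, P.x (t + 1) ω j = P.x t ω j + if j = P.sel t ω then f else 0)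
    (m : ℕ) (ω : P.Ω) (i : Fin n) :
    ((range m).filter fun t => P.sel t ω = i).card ≤ P.x m ω i := by
  induction m with
  | zero => simp
  | succ m ih =>
    obtain ⟨f, hf, hj⟩ := hx m ω
    rw [range_add_one, filter_insert, hj i]
    split_ifs with h1 h2 h2
    · exact (card_insert_le _ _).trans (by omega)
    · exact absurd h1.symm h2
    · omega
    · omega

theorem x_eq_zero_of_sel_ne
    (hx : ∀ t ω, ∃ f : ℕ, 1 ≤ f ∧
      ∀ j, P.x (t + 1) ω j = P.x t ω j + if j = P.sel t ω then f else 0)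
    (m : ℕ) (ω : P.Ω) (i : Fin n) (hi : ∀ t < m, P.sel t ω ≠ i) : P.x m ω i = 0 := by
  induction m with
  | zero => exact P.x_zero ω i
  | succ m ih =>
    obtain ⟨f, -, hj⟩ := hx m ω
    rw [hj i, ih fun t ht => hi t (by omega), if_neg (hi m (by omega)).symm]

/-- After `n / 2` rounds at most half of the bins are nonempty, so the gap is at least half of
every load. -/
theorem half_x_le_Gap
    (hx : ∀ t ω, ∃ f : ℕ, 1 ≤ f ∧
      ∀ j, P.x (t + 1) ω j = P.x t ω j + if j = P.sel t ω then f else 0)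
    (ω : P.Ω) (i : Fin n) : (P.x (n / 2) ω i : ℝ) / 2 ≤ P.Gap (n / 2) ω := by
  have hn : (0 : ℝ) < n := by exact_mod_cast i.pos
  set m := n / 2
  set L : ℝ := ⨆ i, (P.x m ω i : ℝ) with hL
  have hle : ∀ j, (P.x m ω j : ℝ) ≤ L := fun j =>
    le_ciSup (f := fun j => (P.x m ω j : ℝ)) (Set.finite_range _).bddAbove j
  have hL0 : 0 ≤ L := (Nat.cast_nonneg _).trans (hle i)
  have hW : (P.W m ω : ℝ) ≤ m * L := by
    have hsub : ∑ j ∈ (range m).image (fun t => P.sel t ω), (P.x m ω j : ℝ) = P.W m ω := by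
      rw [W, Nat.cast_sum]
      refine sum_subset (subset_univ _) fun j _ hj => ?_
      rw [P.x_eq_zero_of_sel_ne hx m ω j, Nat.cast_zero]
      intro t ht e
      exact hj (mem_image.2 ⟨t, mem_range.2 ht, e⟩)
    rw [← hsub]
    refine (sum_le_card_nsmul _ _ L fun j _ => hle j).trans ?_
    rw [nsmul_eq_mul]
    gcongr
    exact card_image_le.trans (card_range m).le
  have hm : (m : ℝ) ≤ n / 2 := Nat.cast_div_le
  have : (P.W m ω : ℝ) / n ≤ L / 2 := by
    rw [div_le_iff₀ hn]
    nlinarith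
  have := hle i
  unfold Gap
  linarith

variable {P}

/-- With high probability some bin is sampled in each of `k` disjoint blocks of `b` rounds. -/
theorem UniformSampling.measure_forall_x_lt_le (h : P.UniformSampling)
    (hx : ∀ t ω, ∃ f : ℕ, 1 ≤ f ∧
      ∀ j, P.x (t + 1) ω j = P.x t ω j + if j = P.sel t ω then f else 0)
    {m k b : ℕ} (hn : 0 < n) (hb : 0 < b) (hbn : b ≤ n) (hm : k * b ≤ m) :
    P.μ {ω | ∀ i, P.x m ω i < k} ≤ ENNReal.ofReal ((2 * n / b) ^ k / n) := by
  let e : (Fin k → Fin b → Fin n) ≃ (Fin (k * b) → Fin n) :=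
    (Equiv.curry _ _ _).symm.trans (finProdFinEquiv.arrowCongr (Equiv.refl _))
  set bad := univ.filter fun a : Fin k → Fin b → Fin n => ∀ i, ∃ j, ∀ s, a j s ≠ i with hbad
  have hsub : {ω | ∀ i, P.x m ω i < k} ⊆
      {ω | (fun t : Fin (k * b) => P.sel t ω) ∈ bad.map e.toEmbedding} := by
    intro ω hω
    simp only [Set.mem_ofPred_eq, mem_map_equiv, hbad, mem_filter, mem_univ, true_and]
    intro i
    by_contra! hall
    choose s hs using hall
    refine absurd (P.card_filter_sel_le_x hx m ω i) (not_le.2 ((hω i).trans_le ?_))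
    have hinj : Function.Injective fun j : Fin k => (finProdFinEquiv (j, s j) : ℕ) := by
      intro j j' hjj
      exact congrArg Prod.fst (finProdFinEquiv.injective (Fin.ext hjj))
    calc k = (univ.map ⟨_, hinj⟩).card := by simp
      _ ≤ _ := card_le_card fun t ht => by
        obtain ⟨j, -, rfl⟩ := mem_map.1 ht
        refine mem_filter.2 ⟨mem_range.2 ((Fin.is_lt _).trans_le hm), hs j⟩
  refine (measure_mono hsub).trans ((h.measure_sel_mem_le _ _).trans (ENNReal.ofReal_le_ofReal ?_))
  have hcard := card_no_bin_hit_in_all_blocks k hn hb hbn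
  have hn' : (0 : ℝ) < n := by exact_mod_cast hn
  rw [card_map]
  calc (bad.card : ℝ) * (1 / (n : ℝ)) ^ (k * b)
      ≤ (2 * n / b) ^ k / n * ((n : ℝ) ^ b) ^ k * (1 / (n : ℝ)) ^ (k * b) := by gcongr
    _ = _ := by
      rw [← pow_mul, mul_comm b k, mul_assoc, ← mul_pow, mul_one_div_cancel hn'.ne', one_pow,
        mul_one]

end AllocProc

theorem exists_block_parameters {ε : ℝ} (hε : 0 < ε) : ∃ N : ℕ, ∀ n : ℕ, N ≤ n →
    ∃ k b : ℕ, 0 < n ∧ 0 < b ∧ b ≤ n ∧ k * b ≤ n / 2 ∧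
      Real.log n / Real.log (Real.log n) / 5 ≤ k ∧ (2 * n / b : ℝ) ^ k / n ≤ ε := by
  have hlog : Filter.Tendsto (fun n : ℕ => Real.log n) Filter.atTop Filter.atTop :=
    Real.tendsto_log_atTop.comp tendsto_natCast_atTop_atTop
  have h1 : ∀ᶠ n : ℕ in Filter.atTop, 1 ≤ Real.log (Real.log n) :=
    (Real.tendsto_log_atTop.comp hlog).eventually_ge_atTop 1
  have h2 : ∀ᶠ n : ℕ in Filter.atTop, Real.log (Real.log n) ≤ 1 / 10 * Real.log n := by
    filter_upwards [hlog.eventually (Real.isLittleO_log_id_atTop.bound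
      (by norm_num : (0 : ℝ) < 1 / 10)), hlog.eventually_ge_atTop 0] with n hn h0
    simp only [id, Real.norm_eq_abs, abs_of_nonneg h0] at hn
    exact (le_abs_self _).trans hn
  obtain ⟨N, hN⟩ := Filter.eventually_atTop.1 (h1.and (h2.and
    ((hlog.eventually_ge_atTop 10).and ((hlog.eventually_ge_atTop (-(5 / 2) * Real.log ε)).and
      (Filter.eventually_ge_atTop 20)))))
  refine ⟨N, fun n hn => ?_⟩
  obtain ⟨hll, hll', hl, hlε, hn20⟩ := hN n hn
  set l := Real.log n with hl_def
  set k := ⌈l / Real.log l / 5⌉₊ with hk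
  have hn0 : (0 : ℝ) < n := by positivity
  have hn20' : (20 : ℝ) ≤ n := by exact_mod_cast hn20
  have hk1 : (k : ℝ) < l / Real.log l / 5 + 1 := Nat.ceil_lt_add_one (by positivity)
  have hdiv : l / Real.log l ≤ l := div_le_self (by linarith) hll
  have hk0 : 0 < k := Nat.ceil_pos.2 (by positivity)
  have hln : l ≤ n := (Real.log_le_sub_one_of_pos hn0).trans (by linarith)
  have hkn : 4 * k ≤ n := by
    have : (4 * k : ℝ) ≤ n := by linarith
    exact_mod_cast this
  have hkb : k * (n / 2 / k) ≤ n / 2 := Nat.mul_div_le _ _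
  have hkb' : n ≤ 4 * (k * (n / 2 / k)) := by
    have := Nat.div_add_mod (n / 2) k
    have := Nat.mod_lt (n / 2) hk0
    omega
  have hb0 : 0 < n / 2 / k := Nat.pos_of_ne_zero fun h0 => by rw [h0] at hkb'; omega
  refine ⟨k, n / 2 / k, by omega, hb0, ?_, hkb, Nat.le_ceil _, ?_⟩
  · exact (Nat.div_le_self _ _).trans (Nat.div_le_self _ _)
  set b := n / 2 / k
  have hb0' : (0 : ℝ) < b := by exact_mod_cast hb0
  have hkb'' : (n : ℝ) ≤ 4 * (k * b) := by exact_mod_cast hkb'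
  have hbase : 2 * (n : ℝ) / b ≤ Real.exp (2 * Real.log l) := by
    rw [mul_comm 2 (Real.log l), ← Real.rpow_def_of_pos (by linarith), Real.rpow_two,
      div_le_iff₀ hb0']
    have : (8 * k : ℝ) ≤ l ^ 2 := by nlinarith
    nlinarith
  rw [div_le_iff₀ hn0]
  calc (2 * n / b : ℝ) ^ k ≤ Real.exp (2 * Real.log l) ^ k := by gcongr
    _ = Real.exp (k * (2 * Real.log l)) := (Real.exp_nat_mul _ _).symm
    _ ≤ Real.exp (Real.log ε + l) := by
      rw [Real.exp_le_exp]
      have : (k : ℝ) * (2 * Real.log l) ≤ (l / Real.log l / 5 + 1) * (2 * Real.log l) := by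
        gcongr
      have e : (l / Real.log l / 5 + 1) * (2 * Real.log l) = 2 / 5 * l + 2 * Real.log l := by
        field_simp
      linarith
    _ = ε * n := by rw [Real.exp_add, Real.exp_log hε, hl_def, Real.exp_log hn0]

/-- **Lemma 5.2.** Consider any allocation process which at each round picks a uniformly
random bin `i^t` and increments its load by some number `f^t ≥ 1` of balls, where `f^t` may
depend on the history and on `i^t`. Then `Gap(n/2) ≥ (1/10) log n / log log n` with
probability `1 - o(1)` as `n → ∞`. -/
theorem one_bin_lower_bound :
    ∀ ε : ℝ, 0 < ε → ∃ N : ℕ, ∀ n : ℕ, N ≤ n →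
      ∀ P : AllocProc n, P.UniformSampling →
        (∀ t ω, ∃ f : ℕ, 1 ≤ f ∧
          ∀ j, P.x (t + 1) ω j = P.x t ω j + if j = P.sel t ω then f else 0) →
        P.μ {ω | 1 / 10 * (Real.log n / Real.log (Real.log n)) ≤ P.Gap (n / 2) ω}
          ≥ 1 - ENNReal.ofReal ε := by
  intro ε hε
  obtain ⟨N, hN⟩ := exists_block_parameters hε
  refine ⟨N, fun n hn P hP hx => ?_⟩
  obtain ⟨k, b, hn0, hb, hbn, hkb, hk, hle⟩ := hN n hn
  have := P.prob
  let _ := P.m0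
  have hbad := (hP.measure_forall_x_lt_le hx hn0 hb hbn hkb).trans (ENNReal.ofReal_le_ofReal hle)
  rw [ge_iff_le, tsub_le_iff_right]
  calc 1 = P.μ Set.univ := measure_univ.symm
    _ ≤ P.μ ({ω | 1 / 10 * (Real.log n / Real.log (Real.log n)) ≤ P.Gap (n / 2) ω} ∪
          {ω | ∀ i, P.x (n / 2) ω i < k}) := by
        refine measure_mono fun ω _ => ?_
        by_cases hω : ∀ i, P.x (n / 2) ω i < k
        · exact Or.inr hω
        · push Not at hω
          obtain ⟨i, hi⟩ := hω
          have hi' : (k : ℝ) ≤ P.x (n / 2) ω i := by exact_mod_cast hi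
          have := P.half_x_le_Gap hx ω i
          refine Or.inl ?_
          rw [Set.mem_ofPred_eq]
          linarith
    _ ≤ _ := (measure_union_le _ _).trans (by gcongr)
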